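/- arXiv:2211.14600 — 2 statements merged into one kernel-verified Lean document; each statement's English description precedes it below -/
import Mathlib

section
/- A small coherent category C not equivalent to the terminal category is semantically complete if and only if it is weakly Boolean and 2-valued (its subobject lattice Sub(1) of the terminal object has exactly two elements). -/
open CategoryTheory CategoryTheory.Limits

universe w v u v' u'

namespace PosModel

variable {C : Type u} [Category.{v} C] {D : Type u'} [Category.{v'} D]

/-- A natural transformation is *elementary* if each naturality square at a
monomorphism is a pullback square. -/
def Elementary {N M : C ⥤ D} (η : N ⟶ M) : Prop :=
  ∀ ⦃a x : C⦄ (i : a ⟶ x), Mono i →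
    IsPullback (N.map i) (η.app a) (η.app x) (M.map i)

/-- A functor preserves monomorphisms (formulated explicitly). -/
def PreservesMono (F : C ⥤ D) : Prop :=
  ∀ ⦃X Y : C⦄ (f : X ⟶ Y), Mono f → Mono (F.map f)

/-- The subobject represented by a monomorphism (with an explicit proof of
monicity). -/
noncomputable def mkSub {X A : C} (f : A ⟶ X) (h : Mono f) : Subobject X :=
  haveI := h
  Subobject.mk f

/-- The image of a subobject under a mono-preserving functor. -/
noncomputable def mapSub (F : C ⥤ D) (h : PreservesMono F) {X : C} (a : Subobject X) :
    Subobject (F.obj X) :=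
  mkSub (F.map a.arrow) (h a.arrow inferInstance)

/-- The subobject of a functor `M` represented by a pointwise-mono natural
transformation. -/
noncomputable def natSub {N M : C ⥤ D} (α : N ⟶ M) (h : ∀ x : C, Mono (α.app x)) :
    Subobject M :=
  haveI : ∀ x : C, Mono (α.app x) := h
  haveI : Mono α := NatTrans.mono_of_mono_app α
  Subobject.mk α

/-- The axioms of a *coherent category*: a finitely complete category with
(pullback-stable) effective epi–mono factorizations, binary unions of
subobjects and a least subobject of every object, both stable under pullback. -/
structure CoherentData (C : Type u) [Category.{v} C] [HasFiniteLimits C] :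
    Type (max u v) where
  sup : ∀ {X : C}, Subobject X → Subobject X → Subobject X
  le_sup_left : ∀ {X : C} (a b : Subobject X), a ≤ sup a b
  le_sup_right : ∀ {X : C} (a b : Subobject X), b ≤ sup a b
  sup_le : ∀ {X : C} {a b c : Subobject X}, a ≤ c → b ≤ c → sup a b ≤ c
  bot : ∀ X : C, Subobject X
  bot_le : ∀ {X : C} (a : Subobject X), bot X ≤ a
  factor : ∀ {X Y : C} (f : X ⟶ Y), ∃ (Z : C) (e : X ⟶ Z) (m : Z ⟶ Y),
    EffectiveEpi e ∧ Mono m ∧ e ≫ m = f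
  effectiveEpi_pullback : ∀ {P X Y Z : C} (fst : P ⟶ X) (snd : P ⟶ Y) (f : X ⟶ Z) (g : Y ⟶ Z),
    IsPullback fst snd f g → EffectiveEpi g → EffectiveEpi fst
  sup_pullback : ∀ {X Y : C} (f : X ⟶ Y) (a b : Subobject Y),
    (Subobject.pullback f).obj (sup a b) =
      sup ((Subobject.pullback f).obj a) ((Subobject.pullback f).obj b)
  bot_pullback : ∀ {X Y : C} (f : X ⟶ Y),
    (Subobject.pullback f).obj (bot Y) = bot X

/-- The image of a subobject along an arbitrary morphism, computed using the
effective epi–mono factorizations of a coherent category. -/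
noncomputable def CoherentData.img {C : Type u} [Category.{v} C] [HasFiniteLimits C]
    (hC : CoherentData C) {X Y : C} (f : X ⟶ Y) (a : Subobject X) : Subobject Y :=
  mkSub (hC.factor ((a.arrow : (a : C) ⟶ X) ≫ f)).choose_spec.choose_spec.choose
    (hC.factor ((a.arrow : (a : C) ⟶ X) ≫ f)).choose_spec.choose_spec.choose_spec.2.1

/-- A functor between coherent categories is *coherent* if it preserves finite
limits, effective epimorphisms, finite unions of subobjects and the least
subobjects. -/
structure IsCoherent {C : Type u} [Category.{v} C] {D : Type u'} [Category.{v'} D]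
    [HasFiniteLimits C] [HasFiniteLimits D]
    (hC : CoherentData C) (hD : CoherentData D) (F : C ⥤ D) : Prop where
  presLim : Nonempty (PreservesFiniteLimits F)
  presMono : PreservesMono F
  presEpi : ∀ ⦃X Y : C⦄ (f : X ⟶ Y), EffectiveEpi f → EffectiveEpi (F.map f)
  map_sup : ∀ {X : C} (a b : Subobject X),
    mapSub F presMono (hC.sup a b) = hD.sup (mapSub F presMono a) (mapSub F presMono b)
  map_bot : ∀ X : C, mapSub F presMono (hC.bot X) = hD.bot (F.obj X)

/-- Two functors are *elementarily equivalent* if they validate the same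
inclusions of subobjects. -/
def ElemEquiv [HasFiniteLimits C] [HasFiniteLimits D] (M N : C ⥤ D)
    (hM : PreservesMono M) (hN : PreservesMono N) : Prop :=
  ∀ (x : C) (a b : Subobject x),
    (mapSub M hM a ≤ mapSub M hM b) ↔ (mapSub N hN a ≤ mapSub N hN b)

/-- Membership of an element in a subobject of a set. -/
def memSub {X : Type w} (S : Subobject X) (a : X) : Prop :=
  ∃ b : (S : Type w), S.arrow b = a

section Subobjects

variable {C : Type u} [Category.{v} C]

lemma factors_id_iff {X : C} {s : Subobject X} : s.Factors (𝟙 X) ↔ s = ⊤ := by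
  refine ⟨fun h => top_le_iff.mp (Subobject.le_of_factors ?_), fun h => h ▸ Subobject.top_factors _⟩
  simpa using Subobject.factors_of_factors_right (⊤ : Subobject X).arrow h

lemma factors_of_strongEpi_comp {X Y Z : C} {e : X ⟶ Y} [StrongEpi e] {f : Y ⟶ Z}
    {b : Subobject Z} (h : b.Factors (e ≫ f)) : b.Factors f := by
  have sq : CommSq (b.factorThru _ h) e b.arrow f := ⟨by simp⟩
  exact (Subobject.factors_iff _ _).mpr ⟨sq.lift, sq.fac_right⟩

variable [HasFiniteLimits C]

lemma factors_iff_pullback_eq_top {X Y : C} {f : X ⟶ Y} {b : Subobject Y} :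
    b.Factors f ↔ (Subobject.pullback f).obj b = ⊤ := by
  rw [← factors_id_iff, pullback_factors_iff, Category.id_comp]

lemma le_pullback_iff {X Y : C} {f : X ⟶ Y} {s : Subobject X} {b : Subobject Y} :
    s ≤ (Subobject.pullback f).obj b ↔ b.Factors (s.arrow ≫ f) := by
  rw [← pullback_factors_iff]
  exact ⟨fun h => Subobject.factors_of_le _ h (Subobject.factors_self s), Subobject.le_of_factors⟩

lemma CoherentData.eq_bot_of_le (hC : CoherentData C) {X : C} {s : Subobject X}
    (h : s ≤ hC.bot X) : s = hC.bot X :=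
  le_antisymm h (hC.bot_le s)

lemma CoherentData.bot_eq_top_of_hom (hC : CoherentData C) {X Y : C} (f : X ⟶ Y)
    (h : hC.bot Y = ⊤) : hC.bot X = ⊤ := by
  rw [← hC.bot_pullback f, h, Subobject.pullback_top]

lemma CoherentData.factors_bot_iff (hC : CoherentData C) {X Y : C} {f : X ⟶ Y} :
    (hC.bot Y).Factors f ↔ hC.bot X = ⊤ := by
  rw [factors_iff_pullback_eq_top, hC.bot_pullback]

lemma CoherentData.eq_bot_iff (hC : CoherentData C) {X : C} {s : Subobject X} :
    s = hC.bot X ↔ hC.bot (s : C) = ⊤ := by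
  rw [← hC.factors_bot_iff (f := s.arrow)]
  exact ⟨fun h => h ▸ Subobject.factors_self s,
    fun h => hC.eq_bot_of_le (Subobject.le_of_factors h)⟩

lemma CoherentData.factors_of_bot_eq_top (hC : CoherentData C) {X Y : C} {f : X ⟶ Y}
    {b : Subobject Y} (h : hC.bot X = ⊤) : b.Factors f := by
  rw [factors_iff_pullback_eq_top]
  exact top_le_iff.mp (h ▸ hC.bot_le _)

lemma CoherentData.factors_of_sup_eq_top (hC : CoherentData C) {X Y : C} {f : X ⟶ Y}
    {b : Subobject Y} {s t : Subobject X} (h : hC.sup s t = ⊤) (hs : b.Factors (s.arrow ≫ f))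
    (ht : b.Factors (t.arrow ≫ f)) : b.Factors f := by
  rw [factors_iff_pullback_eq_top]
  exact top_le_iff.mp (h ▸ hC.sup_le (le_pullback_iff.mpr hs) (le_pullback_iff.mpr ht))

lemma CoherentData.bot_eq_top_of_strongEpi (hC : CoherentData C) {X Y : C} (e : X ⟶ Y)
    [StrongEpi e] (h : hC.bot X = ⊤) : hC.bot Y = ⊤ := by
  rw [← hC.factors_bot_iff (f := 𝟙 Y)]
  exact factors_of_strongEpi_comp (e := e) (hC.factors_of_bot_eq_top h)

end Subobjects

section FilteredColimits

variable {C : Type u} [Category.{u'} C] {J : Type w} [Category.{v'} J] [Small.{v} J]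

lemma exists_app_eq [HasColimitsOfShape J (Type v)] (F : J ⥤ C ⥤ Type v) {X : C}
    (ξ : (colimit F).obj X) :
    ∃ (j : J) (y : (F.obj j).obj X), (colimit.ι F j).app X y = ξ :=
  Types.jointly_surjective_of_isColimit
    (isColimitOfPreserves ((evaluation C (Type v)).obj X) (colimit.isColimit F)) ξ

variable [IsFiltered J]

lemma exists_map_eq_of_app_eq [HasColimitsOfShape J (Type v)] (F : J ⥤ C ⥤ Type v) {X : C} {j : J}
    {y y' : (F.obj j).obj X} (h : (colimit.ι F j).app X y = (colimit.ι F j).app X y') :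
    ∃ (j' : J) (u : j ⟶ j'), (F.map u).app X y = (F.map u).app X y' :=
  (Types.FilteredColimit.isColimit_eq_iff'
    (isColimitOfPreserves ((evaluation C (Type v)).obj X) (colimit.isColimit F)) y y').mp h

lemma preservesFiniteLimits_colimit [HasColimitsOfShape J (Type v)] (F : J ⥤ C ⥤ Type v)
    (h : ∀ j, PreservesFiniteLimits (F.obj j)) : PreservesFiniteLimits (colimit F) := by
  have : PreservesFiniteLimits F.flip := preservesFiniteLimits_of_evaluation _ h
  exact preservesFiniteLimits_of_natIso (colimitIsoFlipCompColim F).symm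

end FilteredColimits

section Construction

variable {C : Type v} [SmallCategory C]

/-- A directed diagram in `Cᵒᵖ`, that is, a pro-object of `C`, lying over an object `a`. -/
structure ProOver (a : C) where
  /-- The indexing preorder. -/
  I : Type v
  [preorder : Preorder I]
  [directed : IsDirectedOrder I]
  [nonempty : Nonempty I]
  /-- The diagram. -/
  P : I ⥤ Cᵒᵖ
  /-- The cone over `a`. -/
  κ : ∀ i, (P.obj i).unop ⟶ a
  w : ∀ {i j : I} (u : i ⟶ j), (P.map u).unop ≫ κ i = κ j

namespace ProOver

attribute [instance] preorder directed nonempty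

variable {a : C} (p : ProOver a)

/-- The functor pro-represented by a pro-object. -/
noncomputable def functor : C ⥤ Type v := colimit (p.P ⋙ coyoneda)

/-- The coprojection of a stage. -/
noncomputable def ι (i : p.I) : coyoneda.obj (p.P.obj i) ⟶ p.functor :=
  colimit.ι (p.P ⋙ coyoneda) i

lemma map_ι {i j : p.I} (u : i ⟶ j) : coyoneda.map (p.P.map u) ≫ p.ι j = p.ι i :=
  colimit.w (p.P ⋙ coyoneda) u

/-- The element of the pro-represented functor given by a morphism out of a stage. -/
noncomputable def elt {X : C} (i : p.I) (g : (p.P.obj i).unop ⟶ X) : p.functor.obj X :=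
  (p.ι i).app X g

lemma exists_elt {X : C} (ξ : p.functor.obj X) : ∃ i g, p.elt i g = ξ :=
  exists_app_eq _ ξ

lemma map_elt {X Y : C} (i : p.I) (g : (p.P.obj i).unop ⟶ X) (f : X ⟶ Y) :
    p.functor.map f (p.elt i g) = p.elt i (g ≫ f) :=
  (NatTrans.naturality_apply (p.ι i) f g).symm

lemma elt_eq {X : C} {i j : p.I} (u : i ⟶ j) (g : (p.P.obj i).unop ⟶ X) :
    p.elt j ((p.P.map u).unop ≫ g) = p.elt i g :=
  ConcreteCategory.congr_hom (NatTrans.congr_app (p.map_ι u) X) g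

lemma exists_of_elt_eq {X : C} {i : p.I} {g g' : (p.P.obj i).unop ⟶ X}
    (h : p.elt i g = p.elt i g') :
    ∃ (j : p.I) (u : i ⟶ j), (p.P.map u).unop ≫ g = (p.P.map u).unop ≫ g' :=
  exists_map_eq_of_app_eq (p.P ⋙ coyoneda) h

/-- The generic element at the base object. -/
noncomputable def pt : p.functor.obj a := p.elt (Classical.arbitrary p.I) (p.κ _)

lemma elt_κ (i : p.I) : p.elt i (p.κ i) = p.pt := by
  obtain ⟨j, hi, hj⟩ := exists_ge_ge i (Classical.arbitrary p.I)
  rw [pt, ← p.elt_eq (homOfLE hi), p.w, ← p.elt_eq (homOfLE hj) (p.κ _), p.w]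

lemma preservesFiniteLimits_functor : PreservesFiniteLimits p.functor :=
  preservesFiniteLimits_colimit _ fun i => by dsimp; infer_instance

/-- A pro-object over `a` avoids a subobject `b` of `a` if no stage factors through `b`. -/
def Avoids (b : Subobject a) : Prop := ∀ i, ¬ b.Factors (p.κ i)

variable {p} in
lemma Avoids.ne_pt {b : Subobject a} (h : p.Avoids b) {q : C} {k : q ⟶ a} (hk : b.Factors k)
    (ζ : p.functor.obj q) : p.functor.map k ζ ≠ p.pt := by
  obtain ⟨i, g, rfl⟩ := p.exists_elt ζ
  rw [map_elt, ← p.elt_κ i]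
  intro e
  obtain ⟨j, u, hu⟩ := p.exists_of_elt_eq e
  apply h j
  rw [← p.w u, ← hu]
  exact Subobject.factors_of_factors_right _ (Subobject.factors_of_factors_right _ hk)

/-- A morphism into a stage of the pro-object, along which the stage is to be lifted. -/
structure Task where
  /-- The stage. -/
  i : p.I
  /-- The source of the morphism. -/
  Y : C
  /-- The morphism. -/
  f : Y ⟶ (p.P.obj i).unop

/-- The stages of the pro-object obtained by solving all tasks in `T`. -/
abbrev Stage (T : Set p.Task) : Type v :=
  { j : p.I × Finset p.Task // (∀ t ∈ j.2, t.i ≤ j.1) ∧ (j.2 : Set p.Task) ⊆ T }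

variable {p} {T : Set p.Task}

/-- The stage at `i` in which no task is solved. -/
def Stage.base (T : Set p.Task) (i : p.I) : p.Stage T := ⟨(i, ∅), by simp, by simp⟩

instance : Nonempty (p.Stage T) := ⟨Stage.base T (Classical.arbitrary _)⟩

instance : IsDirectedOrder (p.Stage T) where
  directed := by
    classical
    rintro ⟨⟨i, S⟩, h, hS⟩ ⟨⟨i', S'⟩, h', hS'⟩
    dsimp only at h hS h' hS'
    obtain ⟨k, hk, hk'⟩ := exists_ge_ge i i'
    refine ⟨⟨(k, S ∪ S'), fun t ht => ?_, by simp [hS, hS']⟩,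
      ⟨hk, Finset.subset_union_left⟩, ⟨hk', Finset.subset_union_right⟩⟩
    rcases Finset.mem_union.mp ht with ht | ht
    exacts [(h t ht).trans hk, (h' t ht).trans hk']

namespace Stage

/-- The restriction of a stage to the stage of a task. -/
def res (j : p.Stage T) (t : j.1.2) : (p.P.obj j.1.1).unop ⟶ (p.P.obj t.1.i).unop :=
  (p.P.map (homOfLE (j.2.1 t.1 t.2))).unop

lemma map_res {j j' : p.Stage T} (u : j ≤ j') (t : j.1.2) :
    (p.P.map (homOfLE u.1)).unop ≫ j.res t = j'.res ⟨t.1, u.2 t.2⟩ := by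
  rw [res, res, ← unop_comp, ← p.P.map_comp]
  rfl

variable [HasFiniteLimits C] (j : p.Stage T)

/-- The object of solutions of the tasks of a stage. -/
noncomputable def obj : C :=
  pullback (Pi.lift j.res) (Limits.Pi.map fun t : j.1.2 => t.1.f)

/-- The projection from the object of solutions. -/
noncomputable def fst : j.obj ⟶ (p.P.obj j.1.1).unop := pullback.fst _ _

/-- The solution of a task. -/
noncomputable def sol (t : j.1.2) : j.obj ⟶ t.1.Y := pullback.snd _ _ ≫ Pi.π _ t

lemma sol_comp (t : j.1.2) : j.sol t ≫ t.1.f = j.fst ≫ j.res t := by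
  have := (pullback.condition (f := Pi.lift j.res)
    (g := Limits.Pi.map fun t : j.1.2 => t.1.f)) =≫ Pi.π _ t
  simp only [Category.assoc, Limits.Pi.lift_π, Limits.Pi.map_π] at this
  exact (Category.assoc _ _ _).trans this.symm

variable {j} in
@[ext]
lemma hom_ext {W : C} {g h : W ⟶ j.obj} (h₁ : g ≫ j.fst = h ≫ j.fst)
    (h₂ : ∀ t, g ≫ j.sol t = h ≫ j.sol t) : g = h :=
  pullback.hom_ext h₁ (Pi.hom_ext _ _ fun t =>
    (Category.assoc _ _ _).trans ((h₂ t).trans (Category.assoc _ _ _).symm))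

/-- Morphisms into the object of solutions. -/
noncomputable def lift {W : C} (q : W ⟶ (p.P.obj j.1.1).unop) (l : ∀ t : j.1.2, W ⟶ t.1.Y)
    (h : ∀ t, l t ≫ t.1.f = q ≫ j.res t) : W ⟶ j.obj :=
  pullback.lift q (Pi.lift l) (Pi.hom_ext _ _ fun t => by simp [h])

@[simp]
lemma lift_fst {W : C} (q : W ⟶ (p.P.obj j.1.1).unop) (l : ∀ t : j.1.2, W ⟶ t.1.Y)
    (h : ∀ t, l t ≫ t.1.f = q ≫ j.res t) : j.lift q l h ≫ j.fst = q :=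
  pullback.lift_fst _ _ _

@[simp]
lemma lift_sol {W : C} (q : W ⟶ (p.P.obj j.1.1).unop) (l : ∀ t : j.1.2, W ⟶ t.1.Y)
    (h : ∀ t, l t ≫ t.1.f = q ≫ j.res t) (t) : j.lift q l h ≫ j.sol t = l t :=
  (pullback.lift_snd_assoc _ _ _ _).trans (Limits.Pi.lift_π _ _)

variable {j} {j' j'' : p.Stage T}

/-- The transition morphisms between the objects of solutions. -/
noncomputable def trans (u : j ≤ j') : j'.obj ⟶ j.obj :=
  j.lift (j'.fst ≫ (p.P.map (homOfLE u.1)).unop) (fun t => j'.sol ⟨t.1, u.2 t.2⟩) fun t => by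
    rw [Category.assoc, map_res u]
    exact j'.sol_comp ⟨t.1, u.2 t.2⟩

lemma trans_fst (u : j ≤ j') : trans u ≫ j.fst = j'.fst ≫ (p.P.map (homOfLE u.1)).unop :=
  lift_fst ..

lemma trans_sol (u : j ≤ j') (t : j.1.2) : trans u ≫ j.sol t = j'.sol ⟨t.1, u.2 t.2⟩ :=
  lift_sol ..

end Stage

variable [HasFiniteLimits C]

/-- The pro-object obtained by solving all tasks in `T`. -/
noncomputable def extend (p : ProOver a) (T : Set p.Task) : ProOver a where
  I := p.Stage T
  P :=
    { obj := fun j => Opposite.op j.obj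
      map := fun u => (Stage.trans u.le).op
      map_id := fun j => Quiver.Hom.unop_inj (Stage.hom_ext
        (by simp [Stage.trans_fst]) fun t => by simp [Stage.trans_sol])
      map_comp := fun u v => Quiver.Hom.unop_inj (Stage.hom_ext
        (by
          rw [Quiver.Hom.unop_op, Stage.trans_fst, unop_comp, Quiver.Hom.unop_op,
            Quiver.Hom.unop_op, Category.assoc, Stage.trans_fst, ← Category.assoc, Stage.trans_fst,
            Category.assoc, ← unop_comp, ← p.P.map_comp]
          rfl)
        fun t => by simp [Stage.trans_sol]) }
  κ := fun j => j.fst ≫ p.κ j.1.1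
  w := fun u => by
    rw [Quiver.Hom.unop_op, ← Category.assoc, Stage.trans_fst, Category.assoc, p.w]

/-- The stage of the extended pro-object in which no task is solved. -/
def base (p : ProOver a) (T : Set p.Task) (i : p.I) : (p.extend T).I := Stage.base T i

lemma base_mono (p : ProOver a) (T : Set p.Task) : Monotone (p.base T) :=
  fun _ _ h => ⟨h, le_rfl⟩

/-- The projection from the stage in which no task is solved. -/
noncomputable def baseFst (p : ProOver a) (T : Set p.Task) (i : p.I) :
    p.P.obj i ⟶ (p.extend T).P.obj (p.base T i) := (Stage.base T i).fst.op

lemma baseFst_naturality (p : ProOver a) (T : Set p.Task) {i i' : p.I} (u : i ⟶ i') :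
    p.P.map u ≫ p.baseFst T i' =
      p.baseFst T i ≫ (p.extend T).P.map (homOfLE (p.base_mono T u.le)) :=
  Quiver.Hom.unop_inj (Stage.trans_fst (p.base_mono T u.le)).symm

/-- The comparison with the extended pro-object. -/
noncomputable def toExtend (p : ProOver a) (T : Set p.Task) :
    p.functor ⟶ (p.extend T).functor :=
  colimit.desc (p.P ⋙ coyoneda)
    { pt := (p.extend T).functor
      ι :=
        { app := fun i => coyoneda.map (p.baseFst T i) ≫ (p.extend T).ι (p.base T i)
          naturality := fun i i' u => by
            dsimp only [Functor.const_obj_obj, Functor.const_obj_map]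
            rw [Category.comp_id,
              ← (p.extend T).map_ι (homOfLE (p.base_mono T u.le)), Functor.comp_map,
              ← Category.assoc, ← Category.assoc,
              ← Functor.map_comp, ← Functor.map_comp, baseFst_naturality] } }

lemma toExtend_elt {X : C} (i : p.I) (g : (p.P.obj i).unop ⟶ X) :
    (p.toExtend T).app X (p.elt i g) =
      (p.extend T).elt (p.base T i) ((p.baseFst T i).unop ≫ g) :=
  ConcreteCategory.congr_hom (NatTrans.congr_app
    (colimit.ι_desc (F := p.P ⋙ coyoneda) _ i) X) g

lemma extend_elt_fst {X : C} (j : p.Stage T) (g : (p.P.obj j.1.1).unop ⟶ X) :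
    (p.extend T).elt j (j.fst ≫ g) = (p.toExtend T).app X (p.elt j.1.1 g) := by
  have h : p.base T j.1.1 ≤ (show (p.extend T).I from j) := ⟨le_rfl, Finset.empty_subset _⟩
  rw [toExtend_elt, ← (p.extend T).elt_eq (homOfLE h)]
  refine congrArg ((p.extend T).elt j) (.trans (congrArg (· ≫ g) ?_) (Category.assoc _ _ _))
  have e : p.P.map (homOfLE h.1) = 𝟙 (p.P.obj j.1.1) := p.P.map_id _
  refine .trans ?_ (Stage.trans_fst h).symm
  exact (Category.comp_id j.fst).symm.trans (congrArg (j.fst ≫ ·) (congrArg Quiver.Hom.unop e.symm))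

lemma toExtend_pt : (p.toExtend T).app a p.pt = (p.extend T).pt := by
  rw [← p.elt_κ (Classical.arbitrary p.I), toExtend_elt]
  exact (p.extend T).elt_κ (p.base T _)

variable {b : Subobject a}

lemma Avoids.extend_empty (h : p.Avoids b) : (p.extend ∅).Avoids b := by
  intro (j : p.Stage ∅) hj
  have hl : ∀ t : j.1.2, False := fun t => j.2.2 t.2
  let l := j.lift (𝟙 _) (fun t => (hl t).elim) fun t => (hl t).elim
  have e : l ≫ j.fst ≫ p.κ j.1.1 = p.κ j.1.1 := by
    rw [← Category.assoc, Stage.lift_fst, Category.id_comp]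
  exact h j.1.1 (e ▸ Subobject.factors_of_factors_right l hj)

lemma Avoids.exists_maximal (h : p.Avoids b) :
    ∃ T : Set p.Task, Maximal (fun T => (p.extend T).Avoids b) T := by
  have H : ∀ c ⊆ {T : Set p.Task | (p.extend T).Avoids b}, IsChain (· ⊆ ·) c → c.Nonempty →
      (p.extend (⋃₀ c)).Avoids b := by
    intro c hc hchain hne (j : p.Stage _) hj
    obtain ⟨T, hT, hjT⟩ := hchain.directedOn.exists_mem_subset_of_finset_subset_biUnion hne
      (f := id) (by simpa [Set.sUnion_eq_biUnion] using j.2.2)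
    exact hc hT (show (p.extend T).I from ⟨j.1, j.2.1, hjT⟩) hj
  obtain ⟨T, -, hT⟩ := zorn_subset_nonempty _
    (fun c hc hchain hne => ⟨⋃₀ c, H c hc hchain hne, fun _ => Set.subset_sUnion_of_mem⟩)
    ∅ h.extend_empty
  exact ⟨T, hT⟩

/-- The dichotomy satisfied by a maximal extension: an element lifts along a morphism, unless
lifting it forces the generic element into `b`. -/
lemma lift_or_factors_of_maximal {T : Set p.Task}
    (hT : Maximal (fun T => (p.extend T).Avoids b) T) {X Y : C} (ξ : p.functor.obj X)
    (f : Y ⟶ X) :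
    (∃ υ, (p.extend T).functor.map f υ = (p.toExtend T).app X ξ) ∨
      ∃ (q : C) (g : q ⟶ X) (k : q ⟶ a) (ζ : (p.extend T).functor.obj q),
        (p.extend T).functor.map g ζ = (p.toExtend T).app X ξ ∧
        (p.extend T).functor.map k ζ = (p.extend T).pt ∧ b.Factors (pullback.fst g f ≫ k) := by
  classical
  obtain ⟨i, g, rfl⟩ := p.exists_elt ξ
  let t : p.Task := ⟨i, pullback g f, pullback.fst g f⟩
  by_cases ht : t ∈ T
  · left
    let j : p.Stage T := ⟨(i, {t}), by simp [t], by simpa using ht⟩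
    let s : j.1.2 := ⟨t, Finset.mem_singleton_self t⟩
    refine ⟨(p.extend T).elt j (j.sol s ≫ pullback.snd g f), ?_⟩
    have e : (j.sol s ≫ pullback.snd g f) ≫ f = j.fst ≫ j.res s ≫ g := by
      rw [Category.assoc, ← pullback.condition, ← Category.assoc, ← Category.assoc]
      exact congrArg (· ≫ g) (j.sol_comp s)
    exact ((p.extend T).map_elt j _ f).trans ((congrArg ((p.extend T).elt j) e).trans
      ((extend_elt_fst j _).trans (congrArg _ (p.elt_eq _ g))))
  · right
    have hins : ¬ (p.extend (insert t T)).Avoids b := fun h =>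
      ht (hT.2 h (Set.subset_insert t T) (Set.mem_insert t T))
    obtain ⟨j, hj⟩ : ∃ j : p.Stage (insert t T), b.Factors (j.fst ≫ p.κ j.1.1) := by
      by_contra! h
      exact hins h
    have htj : t ∈ j.1.2 := by
      by_contra htj
      exact hT.1 (show (p.extend T).I from
        ⟨j.1, j.2.1, (Set.subset_insert_iff_of_notMem htj).mp j.2.2⟩) hj
    let j₀ : p.Stage T := ⟨(j.1.1, j.1.2.erase t), fun s hs => j.2.1 s (Finset.mem_of_mem_erase hs),
      by simpa [Set.sdiff_singleton_subset_iff] using j.2.2⟩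
    let g' : j₀.obj ⟶ X := j₀.fst ≫ (p.P.map (homOfLE (j.2.1 t htj))).unop ≫ g
    let k : j₀.obj ⟶ a := j₀.fst ≫ p.κ j.1.1
    have hl (s : j.1.2) : ∃ l : pullback g' f ⟶ s.1.Y,
        l ≫ s.1.f = (pullback.fst g' f ≫ j₀.fst) ≫ j.res s := by
      obtain ⟨s, hs⟩ := s
      by_cases hst : s = t
      · subst hst
        exact ⟨pullback.lift ((pullback.fst g' f ≫ j₀.fst) ≫ j.res ⟨t, hs⟩) (pullback.snd g' f)
          (by simpa [g', Stage.res, t] using pullback.condition (f := g') (g := f)),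
          pullback.lift_fst _ _ _⟩
      · exact ⟨pullback.fst g' f ≫ j₀.sol ⟨s, Finset.mem_erase.mpr ⟨hst, hs⟩⟩, by
          rw [Category.assoc, Stage.sol_comp, Category.assoc]; rfl⟩
    choose l hl using hl
    refine ⟨j₀.obj, g', k, (p.extend T).elt j₀ (𝟙 _), ?_, ?_, ?_⟩
    · exact ((p.extend T).map_elt j₀ _ g').trans
        ((congrArg ((p.extend T).elt j₀) (Category.id_comp g')).trans
          ((extend_elt_fst j₀ _).trans (congrArg _ (p.elt_eq _ g))))
    · exact ((p.extend T).map_elt j₀ _ k).trans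
        ((congrArg ((p.extend T).elt j₀) (Category.id_comp k)).trans ((p.extend T).elt_κ j₀))
    · have := Subobject.factors_of_factors_right (j.lift _ l hl) hj
      rwa [← Category.assoc, Stage.lift_fst, Category.assoc] at this

/-- The extension of a pro-object avoiding `b` by a maximal set of tasks. -/
noncomputable def maximalExtension (p : { p : ProOver a // p.Avoids b }) :
    { p : ProOver a // p.Avoids b } :=
  ⟨p.1.extend p.2.exists_maximal.choose, p.2.exists_maximal.choose_spec.prop⟩

/-- The transition to the maximal extension. -/
noncomputable def toMaximalExtension (p : { p : ProOver a // p.Avoids b }) :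
    p.1.functor ⟶ (maximalExtension p).1.functor :=
  p.1.toExtend _

end ProOver

/-- A functor `M` with an element `x` over `a` is *generic* with respect to a subobject `b` of `a`
if `x` does not lie in `b` and every lifting problem for an element of `M` can be solved unless its
solvability would force `x` into `b`. -/
structure IsGeneric [HasFiniteLimits C] {a : C} (b : Subobject a) (M : C ⥤ Type v)
    (x : M.obj a) : Prop where
  preservesFiniteLimits : PreservesFiniteLimits M
  map_ne : ∀ {q : C} (k : q ⟶ a), b.Factors k → ∀ ζ, M.map k ζ ≠ x
  lift_or_factors : ∀ {X Y : C} (ξ : M.obj X) (f : Y ⟶ X), (∃ υ, M.map f υ = ξ) ∨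
    ∃ (q : C) (g : q ⟶ X) (k : q ⟶ a) (ζ : M.obj q), M.map g ζ = ξ ∧ M.map k ζ = x ∧
      b.Factors (pullback.fst g f ≫ k)

open ProOver in
theorem exists_isGeneric [HasFiniteLimits C] {a : C} {b : Subobject a} (hb : b ≠ ⊤) :
    ∃ (M : C ⥤ Type v) (x : M.obj a), IsGeneric b M x := by
  let p₀ : ProOver a :=
    { I := PUnit
      P := (Functor.const _).obj (Opposite.op a)
      κ := fun _ => 𝟙 a
      w := fun _ => Category.id_comp _ }
  have h₀ : p₀.Avoids b := fun _ h => hb (factors_id_iff.mp h)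
  let p : ℕ → { p : ProOver a // p.Avoids b } := Nat.rec ⟨p₀, h₀⟩ fun _ => maximalExtension
  let F : ℕ ⥤ C ⥤ Type v := Functor.ofSequence (X := fun n => (p n).1.functor)
    fun n => toMaximalExtension (p n)
  have hF (n : ℕ) : F.map (homOfLE n.le_succ) = toMaximalExtension (p n) :=
    Functor.ofSequence_map_homOfLE_succ _ n
  let ι (n : ℕ) {X : C} (ξ : (p n).1.functor.obj X) : (colimit F).obj X :=
    (colimit.ι F n).app X ξ
  have hι (n : ℕ) {X : C} (ξ : (p n).1.functor.obj X) :
      ι (n + 1) ((toMaximalExtension (p n)).app X ξ) = ι n ξ := by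
    rw [← hF]
    exact ConcreteCategory.congr_hom (NatTrans.congr_app (colimit.w F _) X) ξ
  have map_ι (n : ℕ) {X Y : C} (f : X ⟶ Y) (ξ : (p n).1.functor.obj X) :
      (colimit F).map f (ι n ξ) = ι n ((p n).1.functor.map f ξ) :=
    (NatTrans.naturality_apply (colimit.ι F n) f ξ).symm
  have map_pt {n m : ℕ} (h : n ≤ m) : (F.map (homOfLE h)).app a (p n).1.pt = (p m).1.pt := by
    induction m, h using Nat.le_induction with
    | base => exact ConcreteCategory.congr_hom (NatTrans.congr_app (F.map_id n) a) _
    | succ m h ih =>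
      have e : F.map (homOfLE (h.trans m.le_succ)) = F.map (homOfLE h) ≫ toMaximalExtension (p m) :=
        (F.map_comp (homOfLE h) (homOfLE m.le_succ)).trans (congrArg (F.map (homOfLE h) ≫ ·) (hF m))
      rw [e]
      exact (congrArg ((toMaximalExtension (p m)).app a) ih).trans toExtend_pt
  have ι_pt (n : ℕ) : ι n (p n).1.pt = ι 0 (p 0).1.pt := by
    induction n with
    | zero => rfl
    | succ n ih =>
      rw [← ih, ← hι n]
      exact congrArg (ι (n + 1)) toExtend_pt.symm
  refine ⟨colimit F, ι 0 (p 0).1.pt, ⟨preservesFiniteLimits_colimit F fun n =>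
    (p n).1.preservesFiniteLimits_functor, fun {q} k hk ζ hζ => ?_, fun {X Y} ξ f => ?_⟩⟩
  · obtain ⟨n, ζ, rfl⟩ := exists_app_eq F ζ
    obtain ⟨m, u, hu⟩ := exists_map_eq_of_app_eq F
      ((map_ι n k ζ).symm.trans (hζ.trans (ι_pt n).symm))
    refine (p m).2.ne_pt hk ((F.map u).app q ζ) ?_
    exact (NatTrans.naturality_apply (F.map u) k ζ).symm.trans (hu.trans (map_pt u.le))
  · obtain ⟨n, ξ, rfl⟩ := exists_app_eq F ξ
    obtain ⟨υ, hυ⟩ | ⟨q, g, k, ζ, hg, hk, hb⟩ :=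
      lift_or_factors_of_maximal (p n).2.exists_maximal.choose_spec ξ f
    · exact .inl ⟨ι (n + 1) υ, (map_ι (n + 1) f υ).trans
        ((congrArg (ι (n + 1)) hυ).trans (hι n ξ))⟩
    · exact .inr ⟨q, g, k, ι (n + 1) ζ,
        (map_ι (n + 1) g ζ).trans ((congrArg (ι (n + 1)) hg).trans (hι n ξ)),
        (map_ι (n + 1) k ζ).trans ((congrArg (ι (n + 1)) hk).trans (ι_pt (n + 1))), hb⟩

end Construction

section Sets

lemma memSub_mk {X Y : Type w} (f : Y ⟶ X) [Mono f] (x : X) :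
    memSub (Subobject.mk f) x ↔ ∃ y, f y = x := by
  constructor
  · rintro ⟨y, rfl⟩
    exact ⟨(Subobject.underlyingIso f).hom y,
      ConcreteCategory.congr_hom (Subobject.underlyingIso_hom_comp_eq_mk f) y⟩
  · rintro ⟨y, rfl⟩
    exact ⟨(Subobject.underlyingIso f).inv y,
      ConcreteCategory.congr_hom (Subobject.underlyingIso_arrow f) y⟩

lemma le_iff_memSub {X : Type w} {S T : Subobject X} :
    S ≤ T ↔ ∀ x, memSub S x → memSub T x := by
  constructor
  · rintro h _ ⟨y, rfl⟩
    exact ⟨Subobject.ofLE S T h y, ConcreteCategory.congr_hom (Subobject.ofLE_arrow h) y⟩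
  · intro h
    choose f hf using fun y : (S : Type w) => h _ ⟨y, rfl⟩
    exact Subobject.le_of_comm (↾f) (by ext y; exact hf y)

lemma exists_memSub_iff {X : Type w} (P : X → Prop) :
    ∃ S : Subobject X, ∀ x, memSub S x ↔ P x := by
  have : Mono (↾(Subtype.val : { x // P x } → X)) :=
    (mono_iff_injective _).mpr Subtype.val_injective
  exact ⟨Subobject.mk (↾(Subtype.val : { x // P x } → X)), fun x => by simp [memSub_mk]⟩

lemma CoherentData.memSub_sup (hT : CoherentData (Type w)) {X : Type w} {S T : Subobject X} {x : X} :
    memSub (hT.sup S T) x ↔ memSub S x ∨ memSub T x := by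
  refine ⟨fun h => ?_, fun h => h.elim (le_iff_memSub.mp (hT.le_sup_left S T) x)
    (le_iff_memSub.mp (hT.le_sup_right S T) x)⟩
  obtain ⟨U, hU⟩ := exists_memSub_iff fun x => memSub S x ∨ memSub T x
  exact (hU x).mp (le_iff_memSub.mp (hT.sup_le (le_iff_memSub.mpr fun y hy => (hU y).mpr (.inl hy))
    (le_iff_memSub.mpr fun y hy => (hU y).mpr (.inr hy))) x h)

lemma CoherentData.not_memSub_bot (hT : CoherentData (Type w)) {X : Type w} (x : X) :
    ¬ memSub (hT.bot X) x := fun h => by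
  obtain ⟨U, hU⟩ := exists_memSub_iff fun _ : X => False
  exact (hU x).mp (le_iff_memSub.mp (hT.bot_le U) x h)

lemma surjective_of_effectiveEpi {X Y : Type w} (f : X ⟶ Y) (h : EffectiveEpi f) :
    Function.Surjective f :=
  (epi_iff_surjective f).mp inferInstance

lemma effectiveEpi_of_surjective {X Y : Type w} (f : X ⟶ Y) (h : Function.Surjective f) :
    EffectiveEpi f := by
  have := (epi_iff_surjective f).mpr h
  have := isSplitEpi_of_epi f
  infer_instance

variable {C : Type u} [Category.{v} C]

lemma memSub_mapSub (M : C ⥤ Type w) (h : PreservesMono M) {X : C} (s : Subobject X)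
    (ξ : M.obj X) : memSub (mapSub M h s) ξ ↔ ∃ η, M.map s.arrow η = ξ :=
  haveI := h s.arrow inferInstance
  memSub_mk _ _

lemma mapSub_le_mapSub_iff {M : C ⥤ Type w} {h : PreservesMono M} {X : C} {s t : Subobject X} :
    mapSub M h s ≤ mapSub M h t ↔ ∀ η, ∃ θ, M.map t.arrow θ = M.map s.arrow η := by
  simp [le_iff_memSub, memSub_mapSub]

section Limits

variable (M : C ⥤ Type w) [PreservesFiniteLimits M] {X Y Z : C}

lemma exists_map_fst_snd_eq [HasPullbacks C] (f : X ⟶ Z) (g : Y ⟶ Z) {α : M.obj X} {β : M.obj Y}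
    (h : M.map f α = M.map g β) :
    ∃ γ, M.map (pullback.fst f g) γ = α ∧ M.map (pullback.snd f g) γ = β :=
  Types.exists_of_isPullback ((IsPullback.of_hasPullback f g).map M) α β h

lemma eq_of_map_fst_snd_eq [HasBinaryProducts C] {α β : M.obj (X ⨯ Y)}
    (h₁ : M.map prod.fst α = M.map prod.fst β) (h₂ : M.map prod.snd α = M.map prod.snd β) :
    α = β :=
  Concrete.isLimit_ext _ (isLimitOfPreserves M (limit.isLimit (pair X Y))) α β
    (by rintro ⟨⟨⟩⟩; exacts [h₁, h₂])

lemma subsingleton_obj_terminal [HasTerminal C] : Subsingleton (M.obj (⊤_ C)) :=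
  ⟨fun α β => Concrete.isLimit_ext _
    (isLimitOfPreserves M (limit.isLimit (Functor.empty.{0} C))) α β (by rintro ⟨⟨⟩⟩)⟩

end Limits

end Sets

section Generic

variable {C : Type v} [SmallCategory C] [HasFiniteLimits C] {a : C} {b : Subobject a}
  {M : C ⥤ Type v} {x : M.obj a}

lemma factors_comp_of_factors_pullback {W q X Y : C} {g : q ⟶ X} {f : Y ⟶ X} {k : q ⟶ a}
    (hb : b.Factors (pullback.fst g f ≫ k)) {h : W ⟶ q} {l : W ⟶ Y} (e : h ≫ g = l ≫ f) :
    b.Factors (h ≫ k) := by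
  have := Subobject.factors_of_factors_right (pullback.lift h l e) hb
  rwa [← Category.assoc, pullback.lift_fst] at this

namespace IsGeneric

variable (h : IsGeneric b M x)

include h

lemma preservesMono : PreservesMono M := fun _ _ _ _ =>
  haveI := h.preservesFiniteLimits
  inferInstance

variable (hC : CoherentData C)

include hC

lemma isEmpty_obj {Z : C} (hZ : hC.bot Z = ⊤) : IsEmpty (M.obj Z) := by
  have := h.preservesFiniteLimits
  refine ⟨fun y => ?_⟩
  have := subsingleton_obj_terminal M
  obtain ⟨γ, -, hγ⟩ := exists_map_fst_snd_eq M (terminal.from Z) (terminal.from a)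
    (Subsingleton.elim (M.map _ y) (M.map _ x))
  exact h.map_ne _ (hC.factors_of_bot_eq_top (hC.bot_eq_top_of_hom (pullback.fst _ _) hZ)) γ hγ

lemma surjective_map {X Y : C} (e : X ⟶ Y) (he : EffectiveEpi e) :
    Function.Surjective (M.map e) := by
  intro ξ
  obtain hυ | ⟨q, g, k, ζ, -, hk, hb⟩ := h.lift_or_factors ξ e
  · exact hυ
  · have := hC.effectiveEpi_pullback _ _ _ _ (IsPullback.of_hasPullback g e) he
    exact (h.map_ne k (factors_of_strongEpi_comp hb) ζ hk).elim

lemma lift_of_sup {X : C} (s t : Subobject X) (y : M.obj (hC.sup s t : C)) :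
    (∃ η, M.map s.arrow η = M.map (hC.sup s t).arrow y) ∨
      ∃ η, M.map t.arrow η = M.map (hC.sup s t).arrow y := by
  have := h.preservesFiniteLimits
  by_contra! hn
  obtain ⟨q₁, g₁, k₁, ζ₁, hg₁, hk₁, hb₁⟩ :=
    (h.lift_or_factors _ s.arrow).resolve_left fun ⟨η, hη⟩ => hn.1 η hη
  obtain ⟨q₂, g₂, k₂, ζ₂, hg₂, hk₂, hb₂⟩ :=
    (h.lift_or_factors _ t.arrow).resolve_left fun ⟨η, hη⟩ => hn.2 η hη
  have e : M.map (prod.lift g₁ k₁) ζ₁ = M.map (prod.lift g₂ k₂) ζ₂ := by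
    apply eq_of_map_fst_snd_eq M
    · rw [← Functor.map_comp_apply, ← Functor.map_comp_apply, prod.lift_fst, prod.lift_fst,
        hg₁, hg₂]
    · rw [← Functor.map_comp_apply, ← Functor.map_comp_apply, prod.lift_snd, prod.lift_snd,
        hk₁, hk₂]
  obtain ⟨γ, hγ, -⟩ := exists_map_fst_snd_eq M _ _ e
  have hc := pullback.condition (f := prod.lift g₁ k₁) (g := prod.lift g₂ k₂)
  have hcg := hc =≫ prod.fst
  have hck := hc =≫ prod.snd
  simp only [Category.assoc, prod.lift_fst, prod.lift_snd] at hcg hck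
  set u := pullback.fst (prod.lift g₁ k₁) (prod.lift g₂ k₂)
  obtain ⟨δ, hδ, -⟩ := exists_map_fst_snd_eq M (u ≫ g₁) (hC.sup s t).arrow
    (α := γ) (β := y) (by rw [Functor.map_comp_apply, hγ, hg₁])
  set r := pullback.fst (u ≫ g₁) (hC.sup s t).arrow with hr
  refine h.map_ne (r ≫ u ≫ k₁) ?_ δ (by
    rw [Functor.map_comp_apply, Functor.map_comp_apply, hδ, hγ, hk₁])
  have hsup : hC.sup ((Subobject.pullback (r ≫ u ≫ g₁)).obj s)
      ((Subobject.pullback (r ≫ u ≫ g₁)).obj t) = ⊤ := by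
    rw [← hC.sup_pullback, ← factors_iff_pullback_eq_top, hr, pullback.condition]
    exact Subobject.factors_of_factors_right _ (Subobject.factors_self _)
  refine hC.factors_of_sup_eq_top hsup ?_ ?_
  · have := le_pullback_iff.mp (le_refl ((Subobject.pullback (r ≫ u ≫ g₁)).obj s))
    have := factors_comp_of_factors_pullback hb₁ (h := Subobject.arrow _ ≫ r ≫ u)
      (l := s.factorThru _ this) (by simp)
    simpa using this
  · have := le_pullback_iff.mp (le_refl ((Subobject.pullback (r ≫ u ≫ g₁)).obj t))
    have := factors_comp_of_factors_pullback hb₂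
      (h := Subobject.arrow _ ≫ r ≫ pullback.snd (prod.lift g₁ k₁) (prod.lift g₂ k₂))
      (l := t.factorThru _ this) (by simp [hcg])
    simpa [hck] using this

theorem isCoherent (hT : CoherentData (Type v)) : IsCoherent hC hT M where
  presLim := ⟨h.preservesFiniteLimits⟩
  presMono := h.preservesMono
  presEpi _ _ e he := effectiveEpi_of_surjective _ (h.surjective_map hC e he)
  map_sup s t := by
    apply le_antisymm
    · rw [le_iff_memSub]
      intro ξ
      rw [hT.memSub_sup, memSub_mapSub, memSub_mapSub, memSub_mapSub]
      rintro ⟨y, rfl⟩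
      exact h.lift_of_sup hC s t y
    · have (r : Subobject _) (hr : r ≤ hC.sup s t) :
          mapSub M h.preservesMono r ≤ mapSub M h.preservesMono (hC.sup s t) :=
        mapSub_le_mapSub_iff.mpr fun η => ⟨M.map (Subobject.ofLE _ _ hr) η, by
          rw [← Functor.map_comp_apply, Subobject.ofLE_arrow]⟩
      exact hT.sup_le (this _ (hC.le_sup_left s t)) (this _ (hC.le_sup_right s t))
  map_bot X := by
    refine hT.eq_bot_of_le (le_iff_memSub.mpr fun ξ => ?_)
    rw [memSub_mapSub]
    rintro ⟨y, -⟩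
    exact ((h.isEmpty_obj hC (hC.eq_bot_iff.mp rfl)).false y).elim

end IsGeneric

end Generic

section Completeness

variable {C : Type v} [SmallCategory C] [HasFiniteLimits C] {hC : CoherentData C}

lemma CoherentData.nonempty_equiv_punit (hC : CoherentData C) (h : hC.bot (⊤_ C) = ⊤) :
    Nonempty (C ≌ Discrete PUnit.{v + 1}) := by
  have hbot (X : C) : hC.bot X = ⊤ := hC.bot_eq_top_of_hom (terminal.from X) h
  have heq {X Y : C} (f g : X ⟶ Y) : f = g := by
    have hf : (Subobject.mk (equalizer.ι f g)).Factors (𝟙 X) :=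
      hC.factors_of_bot_eq_top (hbot X)
    rw [Subobject.mk_factors_iff] at hf
    obtain ⟨l, hl⟩ := hf
    rw [← Category.id_comp f, ← Category.id_comp g, ← hl]
    exact (Category.assoc _ _ _).trans
      ((congrArg (l ≫ ·) (equalizer.condition f g)).trans (Category.assoc _ _ _).symm)
  have hiso (X : C) : IsIso (terminal.from X) := by
    have : Mono (terminal.from X) := ⟨fun _ _ _ => heq _ _⟩
    rw [Subobject.isIso_iff_mk_eq_top, ← top_le_iff, ← h]
    exact hC.bot_le _
  exact (equiv_punit_iff_unique C).mpr ⟨⟨⊤_ C⟩, fun X Y =>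
    ⟨⟨⟨terminal.from X ≫ inv (terminal.from Y)⟩, fun _ => heq _ _⟩⟩⟩

namespace IsCoherent

variable {hT : CoherentData (Type v)} {M : C ⥤ Type v} (hM : IsCoherent hC hT M)

include hM

lemma isEmpty_obj {Z : C} (hZ : hC.bot Z = ⊤) : IsEmpty (M.obj Z) := by
  refine ⟨fun y => hT.not_memSub_bot y ?_⟩
  rw [← hM.map_bot, memSub_mapSub]
  refine ⟨M.map ((hC.bot Z).factorThru (𝟙 Z) (factors_id_iff.mpr hZ)) y, ?_⟩
  rw [← Functor.map_comp_apply, Subobject.factorThru_arrow, Functor.map_id_apply]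

lemma nonempty_obj (h2 : ∀ s : Subobject (⊤_ C), s = hC.bot (⊤_ C) ∨ s = ⊤) {X : C}
    (hX : hC.bot X ≠ ⊤) : Nonempty (M.obj X) := by
  obtain ⟨hlim⟩ := hM.presLim
  obtain ⟨Z, e, m, he, hm, hem⟩ := hC.factor (terminal.from X)
  rcases h2 (Subobject.mk m) with h | h
  · refine (hX (hC.bot_eq_top_of_hom e ?_)).elim
    rw [← hC.factors_bot_iff (f := m), ← h, Subobject.mk_factors_iff]
    exact ⟨𝟙 Z, Category.id_comp m⟩
  · have : IsIso m := (Subobject.isIso_iff_mk_eq_top m).mpr h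
    let z : M.obj (⊤_ C) :=
      (IsTerminal.isTerminalObj M _ terminalIsTerminal).from PUnit PUnit.unit
    exact ⟨(surjective_of_effectiveEpi _ (hM.presEpi e he) (M.map (inv m) z)).choose⟩

lemma mapSub_le_iff (h2 : ∀ s : Subobject (⊤_ C), s = hC.bot (⊤_ C) ∨ s = ⊤)
    (hB : ∀ (x : C) (a b : Subobject x),
      a ≤ b ∨ ∃ u : Subobject x, u ≤ a ∧ u ≠ hC.bot x ∧ u ⊓ b = hC.bot x)
    {x : C} (a b : Subobject x) :
    mapSub M hM.presMono a ≤ mapSub M hM.presMono b ↔ a ≤ b := by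
  obtain ⟨hlim⟩ := hM.presLim
  rw [mapSub_le_mapSub_iff]
  refine ⟨fun h => (hB x a b).resolve_right ?_, fun h η => ⟨M.map (Subobject.ofLE a b h) η, by
    rw [← Functor.map_comp_apply, Subobject.ofLE_arrow]⟩⟩
  rintro ⟨u, hua, hu, hub⟩
  obtain ⟨η⟩ := hM.nonempty_obj h2 (mt hC.eq_bot_iff.mpr hu)
  obtain ⟨θ, hθ⟩ := h (M.map (Subobject.ofLE u a hua) η)
  rw [← Functor.map_comp_apply, Subobject.ofLE_arrow] at hθ
  obtain ⟨γ, -⟩ := exists_map_fst_snd_eq M u.arrow b.arrow hθ.symm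
  refine (hM.isEmpty_obj ?_).false γ
  rw [← hC.factors_bot_iff (f := pullback.fst u.arrow b.arrow ≫ u.arrow), ← hub,
    Subobject.inf_factors]
  refine ⟨Subobject.factors_of_factors_right _ (Subobject.factors_self u), ?_⟩
  rw [pullback.condition]
  exact Subobject.factors_of_factors_right _ (Subobject.factors_self b)

end IsCoherent

variable {hT : CoherentData (Type v)}

lemma eq_bot_or_eq_top_of_elemEquiv
    (h : ∀ (M N : C ⥤ Type v) (hM : IsCoherent hC hT M) (hN : IsCoherent hC hT N),
      ElemEquiv M N hM.presMono hN.presMono) (s : Subobject (⊤_ C)) :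
    s = hC.bot (⊤_ C) ∨ s = ⊤ := by
  by_contra! hs
  obtain ⟨M, x, hM⟩ := exists_isGeneric (mt hC.eq_bot_iff.mpr hs.1)
  obtain ⟨N, y, hN⟩ := exists_isGeneric hs.2
  have hlim := hN.preservesFiniteLimits
  have := subsingleton_obj_terminal N
  have hMN := (h M N (hM.isCoherent hC hT) (hN.isCoherent hC hT) _ s (hC.bot _)).mpr
    (mapSub_le_mapSub_iff.mpr fun η =>
      (hN.map_ne _ (Subobject.factors_self s) η (Subsingleton.elim _ _)).elim)
  obtain ⟨θ, -⟩ := mapSub_le_mapSub_iff.mp hMN x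
  exact (hM.isEmpty_obj hC (hC.eq_bot_iff.mp rfl)).false θ

lemma IsGeneric.exists_inf_eq_bot {M : C ⥤ Type v} {x : M.obj (⊤_ C)}
    (hM : IsGeneric (hC.bot (⊤_ C)) M x) {X : C} {a b : Subobject X} (ξ : M.obj (a : C))
    (hξ : ∀ θ, M.map b.arrow θ ≠ M.map a.arrow ξ) :
    ∃ u : Subobject X, u ≤ a ∧ u ≠ hC.bot X ∧ u ⊓ b = hC.bot X := by
  have hlim := hM.preservesFiniteLimits
  obtain ⟨q, g, k, ζ, hg, -, hb⟩ :=
    (hM.lift_or_factors (M.map a.arrow ξ) b.arrow).resolve_left fun ⟨θ, hθ⟩ => hξ θ hθ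
  rw [hC.factors_bot_iff] at hb
  obtain ⟨γ, -⟩ := exists_map_fst_snd_eq M g a.arrow hg
  obtain ⟨Z, e, m, he, hm, hem⟩ := hC.factor (pullback.fst g a.arrow ≫ g)
  refine ⟨Subobject.mk m, ?_, fun hu => ?_, ?_⟩
  · have ha : a.Factors (e ≫ m) := by
      rw [hem, pullback.condition]
      exact Subobject.factors_of_factors_right _ (Subobject.factors_self a)
    refine Subobject.le_of_factors ?_
    rw [← Subobject.underlyingIso_hom_comp_eq_mk]
    exact Subobject.factors_of_factors_right _ (factors_of_strongEpi_comp ha)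
  · refine (hM.isEmpty_obj hC (hC.bot_eq_top_of_hom e ?_)).false γ
    exact hC.bot_eq_top_of_hom (Subobject.underlyingIso m).inv (hC.eq_bot_iff.mp hu)
  · rw [hC.eq_bot_iff]
    let w : ((Subobject.mk m ⊓ b : Subobject X) : C) ⟶ Z :=
      Subobject.ofLE _ _ inf_le_left ≫ (Subobject.underlyingIso m).hom
    have hw : w ≫ m = Subobject.ofLE _ _ inf_le_right ≫ b.arrow := by simp [w]
    have := hC.effectiveEpi_pullback _ _ _ _ (IsPullback.of_hasPullback w e) he
    refine hC.bot_eq_top_of_strongEpi (pullback.fst w e) (hC.bot_eq_top_of_hom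
      (pullback.lift (pullback.snd w e ≫ pullback.fst g a.arrow)
        (pullback.fst w e ≫ Subobject.ofLE _ _ inf_le_right) ?_) hb)
    rw [Category.assoc, Category.assoc, ← hem, ← hw, pullback.condition_assoc]

lemma le_or_exists_inf_eq_bot_of_elemEquiv
    (h : ∀ (M N : C ⥤ Type v) (hM : IsCoherent hC hT M) (hN : IsCoherent hC hT N),
      ElemEquiv M N hM.presMono hN.presMono) (h1 : hC.bot (⊤_ C) ≠ ⊤) {X : C}
    (a b : Subobject X) :
    a ≤ b ∨ ∃ u : Subobject X, u ≤ a ∧ u ≠ hC.bot X ∧ u ⊓ b = hC.bot X := by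
  rw [or_iff_not_imp_left]
  intro hab
  have hne : (Subobject.pullback a.arrow).obj b ≠ ⊤ := fun e =>
    hab (Subobject.le_of_factors (factors_iff_pullback_eq_top.mpr e))
  obtain ⟨M, x, hM⟩ := exists_isGeneric hne
  obtain ⟨N, y, hN⟩ := exists_isGeneric h1
  have hlim := hM.preservesFiniteLimits
  have hMN := mt (h M N (hM.isCoherent hC hT) (hN.isCoherent hC hT) _ a b).mpr fun hle => by
    obtain ⟨θ, hθ⟩ := mapSub_le_mapSub_iff.mp hle x
    obtain ⟨γ, hγ, -⟩ := exists_map_fst_snd_eq M a.arrow b.arrow hθ.symm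
    refine hM.map_ne _ ?_ γ hγ
    rw [pullback_factors_iff, pullback.condition]
    exact Subobject.factors_of_factors_right _ (Subobject.factors_self b)
  rw [mapSub_le_mapSub_iff] at hMN
  push Not at hMN
  obtain ⟨ξ, hξ⟩ := hMN
  exact hN.exists_inf_eq_bot ξ hξ

end Completeness
/-- A small coherent category `C`, not equivalent to the terminal category, is
semantically complete (any two `Set`-valued coherent functors are elementarily
equivalent) iff it is weakly Boolean and 2-valued (the subobject lattice of the
terminal object has exactly two elements). -/
theorem semanticallyComplete_iff (C : Type v) [SmallCategory C] [HasFiniteLimits C]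
    (hC : CoherentData C) (hT : CoherentData (Type v))
    (hnt : ¬ Nonempty (C ≌ Discrete PUnit.{v + 1})) :
    (∀ (M N : C ⥤ Type v) (hM : IsCoherent hC hT M) (hN : IsCoherent hC hT N),
        ElemEquiv M N hM.presMono hN.presMono) ↔
      ((∀ (x : C) (a b : Subobject x),
          a ≤ b ∨ ∃ u : Subobject x, u ≤ a ∧ u ≠ hC.bot x ∧ u ⊓ b = hC.bot x) ∧
        (hC.bot (⊤_ C) ≠ ⊤ ∧ ∀ s : Subobject (⊤_ C), s = hC.bot (⊤_ C) ∨ s = ⊤)) := by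
  refine ⟨fun h => ?_, fun h M N hM hN x a b => ?_⟩
  · have h1 : hC.bot (⊤_ C) ≠ ⊤ := fun h1 => hnt (hC.nonempty_equiv_punit h1)
    exact ⟨fun x a b => le_or_exists_inf_eq_bot_of_elemEquiv h h1 a b, h1,
      eq_bot_or_eq_top_of_elemEquiv h⟩
  · rw [hM.mapSub_le_iff h.2.2 h.1, hN.mapSub_le_iff h.2.2 h.1]

end PosModel
end

section
/- Let C be a Boolean coherent category (every subobject of every object has a complement in the subobject lattice), let D be a coherent category, and let M, N : C ⥤ D be coherent functors. If there exists an elementary natural transformation α : M ⟶ N, then M and N are elementarily equivalent. -/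
open CategoryTheory CategoryTheory.Limits

universe w v u v' u'

namespace PosModel

variable {C : Type u} [Category.{v} C] {D : Type u'} [Category.{v'} D]

theorem mapSub_le_iff (F : C ⥤ D) (h : PreservesMono F) {X : C} (a b : Subobject X) :
    mapSub F h a ≤ mapSub F h b ↔ ∃ g : F.obj (a : C) ⟶ F.obj (b : C),
      g ≫ F.map b.arrow = F.map a.arrow := by
  have := h a.arrow inferInstance
  have := h b.arrow inferInstance
  exact ⟨fun hab ↦ ⟨Subobject.ofMkLEMk _ _ hab, Subobject.ofMkLEMk_comp hab⟩,
    fun ⟨g, hg⟩ ↦ Subobject.mk_le_mk_of_comm g hg⟩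

theorem mapSub_factors_iff (F : C ⥤ D) (h : PreservesMono F) {X : C} (a : Subobject X)
    {Y : D} (f : Y ⟶ F.obj X) :
    (mapSub F h a).Factors f ↔ ∃ g : Y ⟶ F.obj (a : C), g ≫ F.map a.arrow = f := by
  have := h a.arrow inferInstance
  exact Subobject.mk_factors_iff _ _

theorem mapSub_top (F : C ⥤ D) (h : PreservesMono F) (X : C) :
    mapSub F h (⊤ : Subobject X) = ⊤ :=
  Subobject.mk_eq_top_of_isIso (F.map (⊤ : Subobject X).arrow)

/-- An object of a coherent category is *void* if its least subobject is everything. -/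
def CoherentData.Void [HasFiniteLimits D] (hD : CoherentData D) (X : D) : Prop :=
  (hD.bot X).Factors (𝟙 X)

namespace CoherentData

variable [HasFiniteLimits D] (hD : CoherentData D)

theorem bot_factors_iff_void {X Y : D} (f : X ⟶ Y) : (hD.bot Y).Factors f ↔ hD.Void X := by
  rw [Void, ← hD.bot_pullback f, Limits.pullback_factors_iff, Category.id_comp]

variable {hD}

theorem Void.of_hom {X Y : D} (hY : hD.Void Y) (f : X ⟶ Y) : hD.Void X := by
  rw [← hD.bot_factors_iff_void f, ← Category.comp_id f]
  exact Subobject.factors_of_factors_right f hY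

theorem Void.of_effectiveEpi {X Y : D} (hX : hD.Void X) (e : X ⟶ Y) [EffectiveEpi e] :
    hD.Void Y := by
  have he := (hD.bot_factors_iff_void e).2 hX
  have : StrongEpi ((hD.bot Y).factorThru e he ≫ (hD.bot Y).arrow) := by
    rw [Subobject.factorThru_arrow]
    infer_instance
  have := strongEpi_of_strongEpi ((hD.bot Y).factorThru e he) (hD.bot Y).arrow
  have := isIso_of_mono_of_strongEpi (hD.bot Y).arrow
  have htop := Subobject.eq_top_of_isIso_arrow (hD.bot Y)
  rw [Void, htop]
  exact Subobject.top_factors _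

/-- If `b` and `d` cover `X` and the part of `f` lying over `d` is void, then `f` factors
through `b`. -/
theorem factors_of_sup_eq_top_s18 {X Y : D} {b d : Subobject X} (hbd : hD.sup b d = ⊤) (f : Y ⟶ X)
    (hd : hD.Void ((Subobject.pullback f).obj d : D)) : b.Factors f := by
  have hle : (Subobject.pullback f).obj d ≤ (Subobject.pullback f).obj b :=
    (Subobject.le_of_factors ((hD.bot_factors_iff_void _).2 hd)).trans (hD.bot_le _)
  have htop : (Subobject.pullback f).obj b = ⊤ := by
    rw [← top_le_iff, ← Subobject.pullback_top f, ← hbd, hD.sup_pullback]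
    exact hD.sup_le le_rfl hle
  have := Subobject.top_factors (𝟙 Y)
  rwa [← htop, Limits.pullback_factors_iff, Category.id_comp] at this

end CoherentData

section

variable [HasFiniteLimits C] [HasFiniteLimits D] {hC : CoherentData C} {hD : CoherentData D}

/-- A coherent functor preserves void objects. -/
theorem IsCoherent.void_map {F : C ⥤ D} (hF : IsCoherent hC hD F) {X : C} (hX : hC.Void X) :
    hD.Void (F.obj X) := by
  rw [CoherentData.Void, ← hF.map_bot, mapSub_factors_iff]
  have hbot : (hC.bot X).Factors (𝟙 X) := hX
  refine ⟨F.map ((hC.bot X).factorThru _ hbot), ?_⟩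
  rw [← F.map_comp, Subobject.factorThru_arrow, F.map_id]

/-- An elementary transformation between coherent functors preserves voidness of values:
the value at the support of `X` is determined by the value at the terminal object. -/
theorem Elementary.void_of_void {M N : C ⥤ D} (hM : IsCoherent hC hD M)
    (hN : IsCoherent hC hD N) {α : M ⟶ N} (hα : Elementary α) {X : C}
    (hX : hD.Void (M.obj X)) : hD.Void (N.obj X) := by
  obtain ⟨Z, e, m, he, hm, -⟩ := hC.factor (terminal.from X)
  have := hM.presLim.some
  have := hN.presLim.some
  have := hM.presEpi e he
  have hMZ : hD.Void (M.obj Z) := hX.of_effectiveEpi (M.map e)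
  let tM := terminalIsTerminal.isTerminalObj M (⊤_ C)
  let tN := terminalIsTerminal.isTerminalObj N (⊤_ C)
  exact (hMZ.of_hom ((hα m hm).lift (tM.from _) (𝟙 _) (tN.hom_ext _ _))).of_hom (N.map e)

end

/-- If `C` is a Boolean coherent category (every subobject has a complement),
`D` a coherent category, and `M, N : C ⥤ D` coherent functors, then the
existence of an elementary natural transformation `α : M ⟶ N` implies that `M`
and `N` are elementarily equivalent. -/
theorem elemEquiv_of_elementary_of_boolean {C : Type u} [Category.{v} C]
    {D : Type u'} [Category.{v'} D] [HasFiniteLimits C] [HasFiniteLimits D]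
    (hC : CoherentData C) (hD : CoherentData D)
    -- `C` is Boolean: every subobject has a complement
    (hbool : ∀ {x : C} (a : Subobject x),
      ∃ b : Subobject x, a ⊓ b = hC.bot x ∧ hC.sup a b = ⊤)
    (M N : C ⥤ D) (hM : IsCoherent hC hD M) (hN : IsCoherent hC hD N)
    (α : M ⟶ N) (hα : Elementary α) :
    ElemEquiv M N hM.presMono hN.presMono := by
  intro x a b
  rw [mapSub_le_iff, mapSub_le_iff]
  constructor
  · rintro ⟨g, hg⟩
    obtain ⟨d, hbd, hsup⟩ := hbool b
    have := hM.presLim.some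
    have := hN.presLim.some
    have hvoid : hC.Void (pullback b.arrow d.arrow) := by
      rw [← hC.bot_factors_iff_void (pullback.fst b.arrow d.arrow ≫ b.arrow), ← hbd,
        Subobject.inf_factors]
      refine ⟨Subobject.factors_comp_arrow _, ?_⟩
      rw [pullback.condition]
      exact Subobject.factors_comp_arrow _
    have hMvoid : hD.Void (M.obj (pullback a.arrow d.arrow)) :=
      (hM.void_map hvoid).of_hom <|
        ((IsPullback.of_hasPullback b.arrow d.arrow).map M).lift
          (M.map (pullback.fst _ _) ≫ g) (M.map (pullback.snd _ _)) (by
            rw [Category.assoc, hg, ← M.map_comp, ← M.map_comp, pullback.condition])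
    have hNvoid := hα.void_of_void hM hN hMvoid
    have hNsup : hD.sup (mapSub N hN.presMono b) (mapSub N hN.presMono d) = ⊤ := by
      rw [← hN.map_sup, hsup, mapSub_top]
    rw [← mapSub_factors_iff N hN.presMono]
    refine CoherentData.factors_of_sup_eq_top_s18 hNsup _ ?_
    obtain ⟨k, hk⟩ := (mapSub_factors_iff N hN.presMono d _).1 <|
      (Limits.pullback_factors_iff _ (mapSub N hN.presMono d) _).1 <|
        Subobject.factors_self ((Subobject.pullback (N.map a.arrow)).obj (mapSub N hN.presMono d))
    exact hNvoid.of_hom <|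
      ((IsPullback.of_hasPullback a.arrow d.arrow).map N).lift _ k hk.symm
  · rintro ⟨g, hg⟩
    have hb := hα b.arrow inferInstance
    exact ⟨hb.lift (M.map a.arrow) (α.app _ ≫ g) (by
      rw [Category.assoc, hg, α.naturality]), hb.lift_fst _ _ _⟩

end PosModel
end
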